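/- Let T̂ be the reference triangle with vertices (0,0), (1,0), (0,1) and k ≥ 3. A function ξ̂ in the virtual element space 𝒱^k(T̂) is uniquely determined by its trace Tr ξ̂ ∈ (H^2×H^1)_{k,k−1}(∂T̂) and by its L₂-orthogonal projection Q_{T̂,k−4}ξ̂ onto P_{k−4}(T̂); in particular, if ξ̂ ∈ 𝒱^k(T̂) satisfies Tr ξ̂ = (0,0) and Q_{T̂,k−4}ξ̂ = 0, then ξ̂ = 0. -/

import Mathlib

open MeasureTheory Real Set
open scoped RealInnerProductSpace
noncomputable section

abbrev E2 := EuclideanSpace ℝ (Fin 2)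
def stdb2 (i : Fin 2) : E2 := EuclideanSpace.single i 1
def L2on {n : ℕ} (Ω : Set (EuclideanSpace ℝ (Fin n))) (u : EuclideanSpace ℝ (Fin n) → ℝ) : Prop :=
  MemLp u 2 (volume.restrict Ω)
def IsWeakD {n : ℕ} (Ω : Set (EuclideanSpace ℝ (Fin n)))
    (u v : EuclideanSpace ℝ (Fin n) → ℝ) (d : EuclideanSpace ℝ (Fin n)) : Prop :=
  ∀ φ : EuclideanSpace ℝ (Fin n) → ℝ, ContDiff ℝ (⊤ : ℕ∞) φ → HasCompactSupport φ → tsupport φ ⊆ Ω →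
    ∫ x in Ω, u x * fderiv ℝ φ x d = - ∫ x in Ω, v x * φ x
def tri (p : Fin 3 → E2) : Set E2 := interior (convexHull ℝ (range p))
def evec (p : Fin 3 → E2) (i : Fin 3) : E2 := p (i + 2) - p (i + 1)
def elen (p : Fin 3 → E2) (i : Fin 3) : ℝ := ‖evec p i‖
def tangv (p : Fin 3 → E2) (i : Fin 3) : E2 := (elen p i)⁻¹ • evec p i
def norv (p : Fin 3 → E2) (i : Fin 3) : E2 :=
  EuclideanSpace.single 0 (tangv p i 1) + EuclideanSpace.single 1 (-(tangv p i 0))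
def epar (p : Fin 3 → E2) (i : Fin 3) (t : ℝ) : E2 := p (i + 1) + t • evec p i
def ccw (p : Fin 3 → E2) : Prop :=
  0 < (p 1 - p 0) 0 * (p 2 - p 0) 1 - (p 1 - p 0) 1 * (p 2 - p 0) 0
def tau (i j : Fin 3) : ℝ := if i = j + 1 then 0 else 1

/-- weak derivative on an open interval of `ℝ` -/
def IsWeakD1 (S : Set ℝ) (u v : ℝ → ℝ) : Prop :=
  ∀ φ : ℝ → ℝ, ContDiff ℝ (⊤ : ℕ∞) φ → HasCompactSupport φ → tsupport φ ⊆ S →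
    ∫ t in S, u t * deriv φ t = - ∫ t in S, v t * φ t

def MemHedge : ℕ → (ℝ → ℝ) → Prop
  | 0, u => MemLp u 2 (volume.restrict (Ioo (0:ℝ) 1))
  | (k+1), u => MemLp u 2 (volume.restrict (Ioo (0:ℝ) 1)) ∧
      ∃ v, IsWeakD1 (Ioo (0:ℝ) 1) u v ∧ MemHedge k v

/-- membership of edgewise data in `H²(∂T) × H¹(∂T)` (with pointwise C¹/C⁰ representatives) -/
def MemBdryH2H1 (f g : Fin 3 → ℝ → ℝ) : Prop :=
  ∀ i, MemHedge 2 (f i) ∧ ContDiffOn ℝ 1 (f i) (Icc 0 1) ∧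
    MemHedge 1 (g i) ∧ ContinuousOn (g i) (Icc 0 1)

/-- compatibility conditions (2.2)-(2.4) -/
def Compat (p : Fin 3 → E2) (f g : Fin 3 → ℝ → ℝ) : Prop :=
  (∀ i j k : Fin 3, j ≠ i → k ≠ i → f j (tau i j) = f k (tau i k)) ∧
  ∃ w : Fin 3 → E2, ∀ i j : Fin 3, j ≠ i →
    derivWithin (f j) (Icc 0 1) (tau i j) = elen p j * ⟪w i, tangv p j⟫ ∧
    g j (tau i j) = ⟪w i, norv p j⟫

/-- `H²` membership with explicit weak gradient and Hessian data -/
def MemH2W {n : ℕ} (Ω : Set (EuclideanSpace ℝ (Fin n))) (ξ : EuclideanSpace ℝ (Fin n) → ℝ)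
    (G : Fin n → EuclideanSpace ℝ (Fin n) → ℝ)
    (Hs : Fin n → Fin n → EuclideanSpace ℝ (Fin n) → ℝ) : Prop :=
  L2on Ω ξ ∧ (∀ d, L2on Ω (G d) ∧ IsWeakD Ω ξ (G d) (EuclideanSpace.single d 1)) ∧
  ∀ d d', L2on Ω (Hs d d') ∧ IsWeakD Ω (G d) (Hs d d') (EuclideanSpace.single d' 1)

/-- Gagliardo-type `H^{1/2}` seminorm finiteness for functions on a domain in `ℝⁿ` -/
def GagH12 {n : ℕ} (Ω : Set (EuclideanSpace ℝ (Fin n))) (u : EuclideanSpace ℝ (Fin n) → ℝ) : Prop :=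
  Integrable (fun q : EuclideanSpace ℝ (Fin n) × EuclideanSpace ℝ (Fin n) =>
    (u q.1 - u q.2) ^ 2 / ‖q.1 - q.2‖ ^ (n + 1)) ((volume.restrict Ω).prod (volume.restrict Ω))

/-- membership in `H^{5/2}` of a domain: weak `H²` data whose second derivatives have finite
`H^{1/2}` Gagliardo seminorm. -/
def MemH52 {n : ℕ} (Ω : Set (EuclideanSpace ℝ (Fin n))) (ζ : EuclideanSpace ℝ (Fin n) → ℝ) : Prop :=
  ∃ G Hs, MemH2W Ω ζ G Hs ∧ ∀ d d', GagH12 Ω (Hs d d')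

/-- pointwise trace relation `Tr ζ = (f,g)` on `∂T` for a `C¹` function -/
def TraceEq (p : Fin 3 → E2) (ζ : E2 → ℝ) (f g : Fin 3 → ℝ → ℝ) : Prop :=
  ∀ i : Fin 3, ∀ t ∈ Icc (0:ℝ) 1,
    ζ (epar p i t) = f i t ∧ fderiv ℝ ζ (epar p i t) (norv p i) = g i t

/-- the vector field 𝔤 (2.11) on edge `i`, at parameter `t` -/
def gfield (p : Fin 3 → E2) (f g : Fin 3 → ℝ → ℝ) (i : Fin 3) (t : ℝ) : E2 :=
  ((elen p i)⁻¹ * derivWithin (f i) (Icc 0 1) t) • tangv p i + g i t • norv p i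

/-- the Laplacian of a (smooth) function on `E2` -/
def lap (φ : E2 → ℝ) (x : E2) : ℝ :=
  ∑ i : Fin 2, fderiv ℝ (fun y => fderiv ℝ φ y (stdb2 i)) x (stdb2 i)

/-- `bu` is the edgewise boundary trace of `u` on `∂T` (in the parametrization `epar`),
expressed through the divergence theorem; `Du` is the weak gradient of `u` on `T`. -/
def HasFaceTrace (p : Fin 3 → E2) (u : E2 → ℝ) (Du : Fin 2 → E2 → ℝ)
    (bu : Fin 3 → ℝ → ℝ) : Prop :=
  ∀ φ : E2 → ℝ, ContDiff ℝ (⊤ : ℕ∞) φ → HasCompactSupport φ → ∀ d : Fin 2,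
    ∫ x in tri p, (u x * fderiv ℝ φ x (stdb2 d) + Du d x * φ x)
      = ∑ j : Fin 3, elen p j * ∫ t in Ioo (0:ℝ) 1, bu j t * φ (epar p j t) * norv p j d

/-- `Tr ξ = (f,g)` in the weak (integration by parts) sense: the boundary trace of `ξ`
is `f` and the boundary trace of its gradient is `(∂f/∂t) t + g n` (cf. (2.5), (2.11)). -/
def TraceW (p : Fin 3 → E2) (ξ : E2 → ℝ) (G : Fin 2 → E2 → ℝ)
    (Hs : Fin 2 → Fin 2 → E2 → ℝ) (f g : Fin 3 → ℝ → ℝ) : Prop :=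
  HasFaceTrace p ξ G f ∧
  ∀ d : Fin 2, HasFaceTrace p (G d) (fun d' => Hs d d') (fun j t => gfield p f g j t d)
/-- `u : ℝ → ℝ` is a polynomial of degree at most `m` (`{0}` if `m < 0`) -/
def IsPolyDegLe (m : ℤ) (u : ℝ → ℝ) : Prop :=
  ∃ Q : Polynomial ℝ, (∀ n : ℕ, m < (n : ℤ) → Q.coeff n = 0) ∧ ∀ t, u t = Q.eval t

/-- `u : E2 → ℝ` is a polynomial of total degree at most `m` (`{0}` if `m < 0`) -/
def IsPoly2DegLe (m : ℤ) (u : E2 → ℝ) : Prop :=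
  ∃ Q : MvPolynomial (Fin 2) ℝ,
    (∀ d : Fin 2 →₀ ℕ, m < ((d 0 + d 1 : ℕ) : ℤ) → MvPolynomial.coeff d Q = 0) ∧
    ∀ x : E2, u x = MvPolynomial.eval (fun i => x i) Q

/-- the reference triangle with vertices (0,0), (1,0), (0,1) -/
def refTri : Fin 3 → E2 :=
  ![0, EuclideanSpace.single 0 1, EuclideanSpace.single 1 1]

/-- the distributional bilaplacian of `ξ` on `T` is a polynomial of degree ≤ m -/
def BiharmPoly (p : Fin 3 → E2) (m : ℤ) (ξ : E2 → ℝ) : Prop :=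
  ∃ ρ : E2 → ℝ, IsPoly2DegLe m ρ ∧
    ∀ φ : E2 → ℝ, ContDiff ℝ (⊤ : ℕ∞) φ → HasCompactSupport φ → tsupport φ ⊆ tri p →
      ∫ x in tri p, ξ x * lap (lap φ) x = ∫ x in tri p, ρ x * φ x

/-- `ξ` belongs to the virtual element space `𝒱^k(T)` (defined here for the
reference triangle `p = refTri`), with trace pair `(f,g) ∈ (H²×H¹)_{k,k-1}(∂T)`. -/
def MemVEMT (p : Fin 3 → E2) (k : ℕ) (ξ : E2 → ℝ) (f g : Fin 3 → ℝ → ℝ) : Prop :=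
  (∀ i, IsPolyDegLe (k : ℤ) (f i) ∧ IsPolyDegLe ((k : ℤ) - 1) (g i)) ∧
  Compat p f g ∧
  ∃ G Hs, MemH2W (tri p) ξ G Hs ∧ TraceW p ξ G Hs f g ∧ BiharmPoly p ((k : ℤ) - 4) ξ
open Filter Topology

/-- smooth compactly supported -/
def Tst (φ : E2 → ℝ) : Prop := ContDiff ℝ (⊤ : ℕ∞) φ ∧ HasCompactSupport φ

def pd (φ : E2 → ℝ) (i : Fin 2) (x : E2) : ℝ := fderiv ℝ φ x (stdb2 i)

lemma Tst.pd {φ : E2 → ℝ} (h : Tst φ) (i : Fin 2) : Tst (pd φ i) := by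
  constructor
  · have := (h.1.fderiv_right (m := (⊤ : ℕ∞)) (by simp)).clm_apply (contDiff_const (c := stdb2 i))
    exact this
  · exact h.2.fderiv_apply ℝ (stdb2 i)

lemma lap_eq_pd (φ : E2 → ℝ) (x : E2) : lap φ x = pd (pd φ 0) 0 x + pd (pd φ 1) 1 x := by
  simp only [lap, Fin.sum_univ_two]; rfl

lemma Tst.add {φ ψ : E2 → ℝ} (h : Tst φ) (h' : Tst ψ) : Tst (fun x => φ x + ψ x) :=
  ⟨h.1.add h'.1, h.2.add h'.2⟩

lemma Tst.lap {φ : E2 → ℝ} (h : Tst φ) : Tst (lap φ) := by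
  have : _root_.lap φ = fun x => _root_.pd (_root_.pd φ 0) 0 x + _root_.pd (_root_.pd φ 1) 1 x :=
    funext (lap_eq_pd φ)
  rw [this]
  exact ((h.pd 0).pd 0).add ((h.pd 1).pd 1)

lemma Tst.diff {φ : E2 → ℝ} (h : Tst φ) : Differentiable ℝ φ :=
  h.1.differentiable (by simp)

lemma Tst.memLp {φ : E2 → ℝ} (h : Tst φ) : MemLp φ 2 volume :=
  h.1.continuous.memLp_of_hasCompactSupport h.2

lemma Tst.integ {φ : E2 → ℝ} (h : Tst φ) : Integrable φ volume :=
  h.1.continuous.integrable_of_hasCompactSupport h.2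

lemma pd_affine {φ : E2 → ℝ} (h : Differentiable ℝ φ) (l : ℝ) (b : E2) (i : Fin 2) :
    pd (fun x => φ (l • x + b)) i = fun x => l * pd φ i (l • x + b) := by
  funext x
  have h1 : HasFDerivAt (fun x : E2 => l • x + b) (l • ContinuousLinearMap.id ℝ E2) x :=
    ((hasFDerivAt_id x).const_smul l).add_const b
  have h2 := (h (l • x + b)).hasFDerivAt.comp x h1
  have h3 : fderiv ℝ (fun x => φ (l • x + b)) x = _ := h2.fderiv
  simp [pd, h3]

lemma pd_const_mul {φ : E2 → ℝ} (h : Differentiable ℝ φ) (l : ℝ) (i : Fin 2) (x : E2) :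
    pd (fun x => l * φ x) i x = l * pd φ i x := by
  simp [pd, fderiv_const_mul (h x) l]

lemma lap_affine {φ : E2 → ℝ} (h : Tst φ) (l : ℝ) (b : E2) (x : E2) :
    lap (fun x => φ (l • x + b)) x = l ^ 2 * lap φ (l • x + b) := by
  have key : ∀ i, pd (pd (fun x => φ (l • x + b)) i) i x = l ^ 2 * pd (pd φ i) i (l • x + b) := by
    intro i
    rw [pd_affine h.diff]
    have hd : Differentiable ℝ (fun x : E2 => pd φ i (l • x + b)) :=
      (h.pd i).diff.comp (by fun_prop)
    rw [pd_const_mul hd, pd_affine (h.pd i).diff]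
    ring
  rw [lap_eq_pd, lap_eq_pd, key, key]; ring

lemma lap_const_mul {φ : E2 → ℝ} (h : Tst φ) (l : ℝ) (x : E2) :
    lap (fun x => l * φ x) x = l * lap φ x := by
  have key : ∀ i, pd (pd (fun x => l * φ x) i) i x = l * pd (pd φ i) i x := by
    intro i
    have : pd (fun x => l * φ x) i = fun x => l * pd φ i x :=
      funext fun x => pd_const_mul h.diff l i x
    rw [this, pd_const_mul (h.pd i).diff]
  rw [lap_eq_pd, lap_eq_pd, key, key]; ring

/-- mollification -/
def mol (η u : E2 → ℝ) : E2 → ℝ :=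
  convolution η u (ContinuousLinearMap.lsmul ℝ ℝ) volume

lemma mol_apply (η u : E2 → ℝ) (x : E2) : mol η u x = ∫ t, η t * u (x - t) := rfl

lemma mol_swap (η u : E2 → ℝ) (x : E2) : mol η u x = ∫ t, η (x - t) * u t := by
  unfold mol; rw [convolution_lsmul_swap]; rfl

lemma mol_tst {η u : E2 → ℝ} (hη : Tst η) (hu : LocallyIntegrable u) (hc : HasCompactSupport u) :
    Tst (mol η u) :=
  ⟨hη.2.contDiff_convolution_left _ hη.1 hu, hη.2.convolution _ hc⟩

lemma mol_pd {η u : E2 → ℝ} (hη : Tst η) (hu : LocallyIntegrable u) (i : Fin 2) :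
    pd (mol η u) i = mol (pd η i) u := by
  funext x
  have h := hη.2.hasFDerivAt_convolution_left (ContinuousLinearMap.lsmul ℝ ℝ)
    (hη.1.of_le (by simp)) hu x
  have h' : fderiv ℝ (mol η u) x = _ := h.fderiv
  unfold pd
  rw [h']
  have hex : ConvolutionExistsAt (fderiv ℝ η) u x
      ((ContinuousLinearMap.lsmul ℝ ℝ : ℝ →L[ℝ] ℝ →L[ℝ] ℝ).precompL E2) volume :=
    (hη.2.fderiv ℝ).convolutionExists_left _
      (hη.1.continuous_fderiv (by simp)) hu x
  unfold convolution
  rw [ContinuousLinearMap.integral_apply hex]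
  rfl

lemma mol_lap {η u : E2 → ℝ} (hη : Tst η) (hu : LocallyIntegrable u) (x : E2) :
    lap (mol η u) x = mol (lap η) u x := by
  rw [lap_eq_pd, mol_pd hη hu, mol_pd hη hu, mol_pd (hη.pd 0) hu, mol_pd (hη.pd 1) hu]
  have e : lap η = fun x => pd (pd η 0) 0 x + pd (pd η 1) 1 x := funext (lap_eq_pd η)
  rw [e, mol_apply, mol_apply, mol_apply, ← integral_add]
  · simp only [add_mul]
  · exact ((hη.pd 0).pd 0).2.convolutionExists_left (ContinuousLinearMap.lsmul ℝ ℝ)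
      ((hη.pd 0).pd 0).1.continuous hu x
  · exact ((hη.pd 1).pd 1).2.convolutionExists_left (ContinuousLinearMap.lsmul ℝ ℝ)
      ((hη.pd 1).pd 1).1.continuous hu x

lemma tst_affine {φ : E2 → ℝ} (h : Tst φ) {l : ℝ} (hl : l ≠ 0) (b : E2) :
    Tst (fun x => φ (l • x + b)) := by
  constructor
  · exact h.1.comp (by fun_prop)
  · exact h.2.comp_homeomorph ((Homeomorph.smulOfNeZero l hl).trans (Homeomorph.addRight b))

/-- Laplacian of mollification, weak form -/
lemma mol_lap_weak {η ξ w : E2 → ℝ} (hη : Tst η) (hu : LocallyIntegrable ξ)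
    (hw : ∀ φ, Tst φ → ∫ x, ξ x * lap φ x = ∫ x, w x * φ x) (x : E2) :
    lap (mol η ξ) x = mol η w x := by
  rw [mol_lap hη hu, mol_swap, mol_swap]
  have h := hw _ (tst_affine hη (l := -1) (by norm_num) x)
  have e : ∀ t : E2, (-1 : ℝ) • t + x = x - t := fun t => by simp [sub_eq_add_neg, add_comm]
  simp only [lap_affine hη] at h
  simp only [e] at h
  simpa [mul_comm] using h

lemma tst_harm_zero {ψ : E2 → ℝ} (h : Tst ψ) (hl : ∀ x, lap ψ x = 0) : ψ = 0 := by
  have ibp : ∀ i, ∫ x, ψ x * pd (pd ψ i) i x = - ∫ x, pd ψ i x * pd ψ i x := by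
    intro i
    apply integral_mul_fderiv_eq_neg_fderiv_mul_of_integrable
    · exact (h.pd i).memLp.integrable_mul (h.pd i).memLp
    · exact h.memLp.integrable_mul ((h.pd i).pd i).memLp
    · exact h.memLp.integrable_mul (h.pd i).memLp
    · exact fun x _ => h.diff x
    · exact fun x _ => (h.pd i).diff x
  have hi : ∀ i, Integrable (fun x => pd ψ i x * pd ψ i x) :=
    fun i => (h.pd i).memLp.integrable_mul (h.pd i).memLp
  have h0 : ∫ x, (pd ψ 0 x * pd ψ 0 x + pd ψ 1 x * pd ψ 1 x) = 0 := by
    rw [integral_add (hi 0) (hi 1)]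
    have : ∫ x, ψ x * lap ψ x = 0 := by simp [hl]
    simp only [lap_eq_pd, mul_add] at this
    have hj : ∀ i, Integrable (fun x => ψ x * pd (pd ψ i) i x) :=
      fun i => h.memLp.integrable_mul ((h.pd i).pd i).memLp
    rw [integral_add (hj 0) (hj 1), ibp, ibp] at this
    linarith
  have hc : Continuous (fun x => pd ψ 0 x * pd ψ 0 x + pd ψ 1 x * pd ψ 1 x) :=
    ((h.pd 0).1.continuous.mul (h.pd 0).1.continuous).add
      ((h.pd 1).1.continuous.mul (h.pd 1).1.continuous)
  have hz : (fun x => pd ψ 0 x * pd ψ 0 x + pd ψ 1 x * pd ψ 1 x) = 0 := by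
    have := (integral_eq_zero_iff_of_nonneg (fun x => by
      show (0:ℝ) ≤ pd ψ 0 x * pd ψ 0 x + pd ψ 1 x * pd ψ 1 x
      nlinarith [mul_self_nonneg (pd ψ 0 x), mul_self_nonneg (pd ψ 1 x)])
      ((hi 0).add (hi 1))).1 h0
    exact Continuous.ae_eq_iff_eq volume hc continuous_const |>.1 this
  have hfd : ∀ x, fderiv ℝ ψ x = 0 := by
    intro x
    have hx := congrFun hz x
    simp only [Pi.zero_apply] at hx
    have e0 : pd ψ 0 x = 0 := by
      nlinarith [mul_self_nonneg (pd ψ 0 x), mul_self_nonneg (pd ψ 1 x)]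
    have e1 : pd ψ 1 x = 0 := by
      nlinarith [mul_self_nonneg (pd ψ 0 x), mul_self_nonneg (pd ψ 1 x)]
    ext v
    have hv : v = v 0 • stdb2 0 + v 1 • stdb2 1 := by
      ext j; fin_cases j <;> simp [stdb2]
    rw [hv, map_add, map_smul, map_smul]
    change v 0 • pd ψ 0 x + v 1 • pd ψ 1 x = _
    simp [e0, e1]
  have hconst := is_const_of_fderiv_eq_zero h.diff hfd
  by_contra hne
  have : ∃ x, x ∉ tsupport ψ := by
    by_contra hcon
    push Not at hcon
    have : IsCompact (univ : Set E2) := by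
      rw [← eq_univ_of_forall hcon]; exact h.2
    exact noncompact_univ E2 this
  obtain ⟨x, hx⟩ := this
  apply hne
  funext y
  rw [hconst y x]; exact image_eq_zero_of_notMem_tsupport hx

lemma int_affine (f : E2 → ℝ) {l : ℝ} (hl : l ≠ 0) (b : E2) :
    ∫ x, f (l • x + b) = (l ^ 2)⁻¹ * ∫ x, f x := by
  have h := Measure.integral_comp_smul (volume : Measure E2) (fun x => f (x + b)) l
  rw [h, integral_add_right_eq_self f b, finrank_euclideanSpace_fin, smul_eq_mul,
    abs_of_pos (by positivity)]

lemma integrable_affine {f : E2 → ℝ} (hf : Integrable f) {l : ℝ} (hl : l ≠ 0) (b : E2) :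
    Integrable (fun x => f (l • x + b)) :=
  (hf.comp_add_right b).comp_smul hl

lemma aesm_affine {f : E2 → ℝ} (hf : AEStronglyMeasurable f volume) {l : ℝ} (hl : l ≠ 0) (b : E2) :
    AEStronglyMeasurable (fun x => f (l • x + b)) volume := by
  have h1 : Measure.QuasiMeasurePreserving (fun x : E2 => l • x) volume volume := by
    refine ⟨by fun_prop, ?_⟩
    rw [Measure.map_addHaar_smul _ hl]
    exact Measure.smul_absolutelyContinuous
  have h2 : Measure.QuasiMeasurePreserving (fun x : E2 => x + b) volume volume :=
    (measurePreserving_add_right volume b).quasiMeasurePreserving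
  exact hf.comp_quasiMeasurePreserving (h2.comp h1)

lemma memLp_affine {f : E2 → ℝ} (hf : MemLp f 2 volume) {l : ℝ} (hl : l ≠ 0) (b : E2) :
    MemLp (fun x => f (l • x + b)) 2 volume := by
  rw [memLp_two_iff_integrable_sq (aesm_affine hf.1 hl b)]
  exact integrable_affine (f := fun x => f x ^ 2) hf.integrable_sq hl b

lemma memLp_sub_right {f : E2 → ℝ} (hf : MemLp f 2 volume) (y : E2) :
    MemLp (fun x => f (x - y)) 2 volume := by
  have := memLp_affine hf one_ne_zero (-y)
  simpa [sub_eq_add_neg] using this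

lemma fubini_mol {a v η : E2 → ℝ} (ha : MemLp a 2 volume) (hv : MemLp v 2 volume) (hη : Tst η) :
    Integrable (fun y => η y * ∫ z, a z * v (z - y)) ∧
    ∫ z, a z * mol η v z = ∫ y, η y * ∫ z, a z * v (z - y) := by
  have hm : AEStronglyMeasurable (fun p : E2 × E2 => a p.1 * (η p.2 * v (p.1 - p.2)))
      (volume.prod volume) := by
    apply ha.1.comp_fst.mul
    exact hη.integ.1.convolution_integrand (ContinuousLinearMap.lsmul ℝ ℝ) hv.1
  have h1 : Integrable (fun p : E2 × E2 => a p.1 ^ 2 * |η p.2|) (volume.prod volume) :=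
    ha.integrable_sq.mul_prod hη.integ.abs
  have h2 : Integrable (fun p : E2 × E2 => |η p.2| * v (p.1 - p.2) ^ 2) (volume.prod volume) :=
    hη.integ.abs.convolution_integrand (ContinuousLinearMap.lsmul ℝ ℝ) hv.integrable_sq
  have hI : Integrable (fun p : E2 × E2 => a p.1 * (η p.2 * v (p.1 - p.2)))
      (volume.prod volume) := by
    refine (h1.add h2).mono' hm (Eventually.of_forall fun p => ?_)
    simp only [norm_mul, Real.norm_eq_abs, Pi.add_apply]
    have h3 : |a p.1| * |v (p.1 - p.2)| ≤ a p.1 ^ 2 + v (p.1 - p.2) ^ 2 := by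
      rw [← sq_abs (a p.1), ← sq_abs (v _)]
      nlinarith [sq_nonneg (|a p.1| - |v (p.1 - p.2)|), sq_nonneg (|a p.1| + |v (p.1 - p.2)|)]
    nlinarith [mul_le_mul_of_nonneg_left h3 (abs_nonneg (η p.2))]
  have e : ∀ y, ∫ z, a z * (η y * v (z - y)) = η y * ∫ z, a z * v (z - y) := by
    intro y
    rw [← integral_const_mul]
    congr 1; funext z; ring
  constructor
  · have := hI.integral_prod_right
    simpa only [e] using this
  · have := integral_integral_swap (f := fun z y => a z * (η y * v (z - y))) hI
    simp only [e] at this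
    rw [← this]
    congr 1; funext z
    rw [integral_const_mul, mol_apply]

lemma poly_affine {m : ℤ} {u : E2 → ℝ} (hu : IsPoly2DegLe m u) (l : ℝ) (b : E2) :
    IsPoly2DegLe m (fun x => u (l • x + b)) := by
  obtain ⟨Q, hQ, he⟩ := hu
  let P : Fin 2 → MvPolynomial (Fin 2) ℝ :=
    fun i => MvPolynomial.C l * MvPolynomial.X i + MvPolynomial.C (b i)
  have hP : ∀ i, (P i).totalDegree ≤ 1 := by
    intro i
    refine (MvPolynomial.totalDegree_add _ _).trans (max_le ?_ (by simp))
    refine (MvPolynomial.totalDegree_mul _ _).trans (by simp)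
  refine ⟨MvPolynomial.bind₁ P Q, ?_, ?_⟩
  · intro d hd
    have hform : MvPolynomial.bind₁ P Q
        = ∑ e ∈ Q.support, MvPolynomial.C (Q.coeff e) * ∏ i, P i ^ e i := by
      conv_lhs => rw [Q.as_sum]
      rw [map_sum]
      refine Finset.sum_congr rfl fun e _ => ?_
      rw [MvPolynomial.bind₁_monomial]
      congr 1
      exact Finsupp.prod_fintype e (fun i n => P i ^ n) (by simp)
    rw [hform, MvPolynomial.coeff_sum]
    refine Finset.sum_eq_zero fun e he' => ?_
    have hem : ((e 0 + e 1 : ℕ) : ℤ) ≤ m := by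
      by_contra hcon
      exact (MvPolynomial.mem_support_iff.1 he') (hQ e (not_le.1 hcon))
    apply MvPolynomial.coeff_eq_zero_of_totalDegree_lt
    have hd' : ∑ i ∈ d.support, d i = d 0 + d 1 := by
      have : d.sum (fun _ n => n) = ∑ i, d i := Finsupp.sum_fintype _ _ (by simp)
      rw [Finsupp.sum] at this
      rw [this, Fin.sum_univ_two]
    rw [hd']
    have : (MvPolynomial.C (Q.coeff e) * ∏ i, P i ^ e i).totalDegree ≤ e 0 + e 1 := by
      refine (MvPolynomial.totalDegree_mul _ _).trans ?_
      rw [MvPolynomial.totalDegree_C, zero_add, Fin.prod_univ_two]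
      refine (MvPolynomial.totalDegree_mul _ _).trans ?_
      refine add_le_add ?_ ?_
      · refine (MvPolynomial.totalDegree_pow _ _).trans ?_
        simpa using Nat.mul_le_mul_left (e 0) (hP 0)
      · refine (MvPolynomial.totalDegree_pow _ _).trans ?_
        simpa using Nat.mul_le_mul_left (e 1) (hP 1)
    omega
  · intro x
    show u (l • x + b) = _
    rw [he]
    simp only [MvPolynomial.eval, MvPolynomial.eval₂Hom_bind₁]
    congr 2
    funext i
    simp [P]

lemma poly_continuous {m : ℤ} {u : E2 → ℝ} (hu : IsPoly2DegLe m u) : Continuous u := by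
  obtain ⟨Q, -, he⟩ := hu
  have : u = fun x : E2 => MvPolynomial.eval (fun i => x i) Q := funext he
  rw [this]
  exact (MvPolynomial.continuous_eval Q).comp (by fun_prop)

/-- Continuity of dilation and translation in `L²`, quantitative form. -/
lemma corr_pos {w : E2 → ℝ} (hw : MemLp w 2 volume) (c : E2) (hI : 0 < ∫ x, w x ^ 2) :
    ∃ δ > 0, ∀ μ : ℝ, 1 - δ < μ → μ < 1 → ∀ y : E2, ‖y‖ < δ →
      (∫ x, w x ^ 2) / 2 ≤ ∫ z, w (μ • z + (1 - μ) • c) * w (z - y) := by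
  set I := ∫ x, w x ^ 2 with hIdef
  have hw' : MemLp w (ENNReal.ofReal 2) volume := by simpa using hw
  obtain ⟨h, hsupp, happ, hcont, hh⟩ :=
    hw'.exists_hasCompactSupport_integral_rpow_sub_le (p := 2) (by norm_num)
      (show 0 < I / 100 by positivity)
  have hh : MemLp h 2 volume := by simpa using hh
  have happ : ∫ x, (w x - h x) ^ 2 ≤ I / 100 := by
    refine le_trans (le_of_eq ?_) happ
    congr 1; funext x
    rw [Real.norm_eq_abs, Real.rpow_two, sq_abs]
  -- the continuous part
  have hsmall : ∃ δ > 0, ∀ μ : ℝ, 1 - δ < μ → μ < 1 → ∀ y : E2, ‖y‖ < δ →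
      1 / 2 < μ ∧ ∫ z, (h (μ • z + (1 - μ) • c) - h (z - y)) ^ 2 ≤ I / 100 := by
    obtain ⟨R, hR⟩ := hsupp.isCompact.isBounded.subset_closedBall 0
    have hz0 : ∀ x : E2, R < ‖x‖ → h x = 0 := fun x hx =>
      image_eq_zero_of_notMem_tsupport fun hmem => by
        have := hR hmem
        rw [mem_closedBall_zero_iff] at this
        linarith
    let K := Metric.closedBall (0 : E2) (2 * |R| + ‖c‖ + 1)
    have hK : IsCompact K := isCompact_closedBall _ _
    let F : ℝ × E2 → E2 → ℝ := fun q z => (h (q.1 • z + (1 - q.1) • c) - h (z - q.2)) ^ 2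
    have hF : Continuous F.uncurry := by
      simp only [F, Function.uncurry_def]
      fun_prop
    have hFc : Continuous (fun q => ∫ z in K, F q z) :=
      continuous_parametric_integral_of_continuous hF hK
    have h1 := hFc.tendsto (1, 0)
    have e0 : ∫ z in K, F (1, 0) z = 0 := by simp [F]
    rw [e0] at h1
    have h2 := h1.eventually (gt_mem_nhds (show (0:ℝ) < I / 100 by positivity))
    obtain ⟨δ, hδ, hball⟩ := Metric.eventually_nhds_iff.1 h2
    refine ⟨min δ (1 / 2), by positivity, fun μ hμ hμ1 y hy => ?_⟩
    have hμδ : 1 - μ < δ := by have := min_le_left δ (1/2); linarith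
    have hμ2 : 1 / 2 < μ := by have := min_le_right δ (1/2); linarith
    have hyδ : ‖y‖ < δ := lt_of_lt_of_le hy (min_le_left _ _)
    have hy1 : ‖y‖ < 1 / 2 := lt_of_lt_of_le hy (min_le_right _ _)
    refine ⟨hμ2, ?_⟩
    have h3 := hball (y := (μ, y)) (by
      rw [Prod.dist_eq, max_lt_iff]
      constructor
      · simp only [Real.dist_eq]; rw [abs_sub_comm, abs_of_pos] <;> linarith
      · simpa using hyδ)
    rw [setIntegral_eq_integral_of_forall_compl_eq_zero] at h3
    · exact h3.le
    · intro z hz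
      have hz' : 2 * |R| + ‖c‖ + 1 < ‖z‖ := by
        simpa [K] using hz
      have hRR := le_abs_self R
      have hR0 := abs_nonneg R
      have hc0 := norm_nonneg c
      have a1 : h (μ • z + (1 - μ) • c) = 0 := by
        apply hz0
        have n1 : ‖μ • z‖ = μ * ‖z‖ := by
          rw [norm_smul, Real.norm_eq_abs, abs_of_pos (by linarith)]
        have n2 : ‖(1 - μ) • c‖ = (1 - μ) * ‖c‖ := by
          rw [norm_smul, Real.norm_eq_abs, abs_of_pos (by linarith)]
        have n3 := norm_sub_le (μ • z + (1 - μ) • c) ((1 - μ) • c)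
        rw [add_sub_cancel_right, n1, n2] at n3
        nlinarith
      have a2 : h (z - y) = 0 := by
        apply hz0
        have := norm_sub_norm_le z y
        linarith
      simp [F, a1, a2]
  obtain ⟨δ, hδ, H⟩ := hsmall
  refine ⟨δ, hδ, fun μ hμ hμ1 y hy => ?_⟩
  obtain ⟨hμ2, hsm⟩ := H μ hμ hμ1 y hy
  have hμ0 : μ ≠ 0 := by linarith
  set b := (1 - μ) • c
  have m1 : MemLp (fun z => w (μ • z + b)) 2 volume := memLp_affine hw hμ0 b
  have m2 : MemLp (fun z => w (z - y)) 2 volume := memLp_sub_right hw y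
  have m3 : MemLp (fun z => h (μ • z + b)) 2 volume := memLp_affine hh hμ0 b
  have m4 : MemLp (fun z => h (z - y)) 2 volume := memLp_sub_right hh y
  have j1 : ∫ z, w (μ • z + b) ^ 2 = (μ ^ 2)⁻¹ * I := int_affine (fun x => w x ^ 2) hμ0 b
  have j2 : ∫ z, w (z - y) ^ 2 = I := integral_sub_right_eq_self (fun x => w x ^ 2) y
  have j3 : ∫ z, (w (μ • z + b) - h (μ • z + b)) ^ 2 = (μ ^ 2)⁻¹ * ∫ x, (w x - h x) ^ 2 :=
    int_affine (fun x => (w x - h x) ^ 2) hμ0 b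
  have j4 : ∫ z, (w (z - y) - h (z - y)) ^ 2 = ∫ x, (w x - h x) ^ 2 :=
    integral_sub_right_eq_self (fun x => (w x - h x) ^ 2) y
  have i1 : Integrable (fun z => w (μ • z + b) ^ 2) := m1.integrable_sq
  have i2 : Integrable (fun z => w (z - y) ^ 2) := m2.integrable_sq
  have i3 : Integrable (fun z => (w (μ • z + b) - h (μ • z + b)) ^ 2) := (m1.sub m3).integrable_sq
  have i4 : Integrable (fun z => (w (z - y) - h (z - y)) ^ 2) := (m2.sub m4).integrable_sq
  have i5 : Integrable (fun z => (h (μ • z + b) - h (z - y)) ^ 2) := (m3.sub m4).integrable_sq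
  have i6 : Integrable (fun z => w (μ • z + b) * w (z - y)) := m1.integrable_mul m2
  have hle : ∫ z, ((w (μ • z + b) ^ 2 + w (z - y) ^ 2)
      - 3 * (((w (μ • z + b) - h (μ • z + b)) ^ 2 + (h (μ • z + b) - h (z - y)) ^ 2)
        + (w (z - y) - h (z - y)) ^ 2)) ≤ ∫ z, 2 * (w (μ • z + b) * w (z - y)) := by
    refine integral_mono ((i1.add i2).sub (((i3.add i5).add i4).const_mul 3)) (i6.const_mul 2)
      fun z => ?_
    simp only
    generalize w (μ • z + b) = A
    generalize w (z - y) = B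
    generalize h (μ • z + b) = C
    generalize h (z - y) = D
    nlinarith [sq_nonneg ((A - C) - (C - D)), sq_nonneg ((A - C) + (B - D)),
      sq_nonneg ((C - D) + (B - D))]
  have i12 : Integrable (fun z => w (μ • z + b) ^ 2 + w (z - y) ^ 2) := i1.add i2
  have i35 : Integrable (fun z => (w (μ • z + b) - h (μ • z + b)) ^ 2
    + (h (μ • z + b) - h (z - y)) ^ 2) := i3.add i5
  have i354 : Integrable (fun z => (w (μ • z + b) - h (μ • z + b)) ^ 2
    + (h (μ • z + b) - h (z - y)) ^ 2 + (w (z - y) - h (z - y)) ^ 2) := i35.add i4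
  rw [integral_const_mul, integral_sub i12 (i354.const_mul 3),
    integral_add i1 i2, integral_const_mul, integral_add i35 i4, integral_add i3 i5,
    j1, j2, j3, j4] at hle
  have hμi : (1:ℝ) ≤ (μ ^ 2)⁻¹ := by
    rw [one_le_inv₀ (by positivity)]; nlinarith
  have hμi4 : (μ ^ 2)⁻¹ ≤ 4 := by
    rw [inv_le_comm₀ (by positivity) (by norm_num)]; nlinarith
  have hE0 : 0 ≤ ∫ x, (w x - h x) ^ 2 := integral_nonneg fun x => sq_nonneg _
  nlinarith

lemma core {T : Set E2} (hTo : IsOpen T) (hTc : Convex ℝ T) (hTb : Bornology.IsBounded T)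
    {ξ w : E2 → ℝ} (hξ : MemLp ξ 2 volume) (hw : MemLp w 2 volume)
    (hξ0 : ∀ x, x ∉ T → ξ x = 0)
    (hweak : ∀ φ, Tst φ → ∫ x, ξ x * lap φ x = ∫ x, w x * φ x)
    {m : ℤ} {ρ : E2 → ℝ} (hρ : IsPoly2DegLe m ρ)
    (hbi : ∀ φ, Tst φ → tsupport φ ⊆ T → ∫ x, ξ x * lap (lap φ) x = ∫ x in T, ρ x * φ x)
    (hmom : ∀ q, IsPoly2DegLe m q → ∫ x, ξ x * q x = 0) : ξ =ᵐ[volume] 0 := by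
  rcases T.eq_empty_or_nonempty with hTe | ⟨c, hc⟩
  · exact Eventually.of_forall fun x => hξ0 x (by simp [hTe])
  have hli : LocallyIntegrable ξ := hξ.locallyIntegrable (by norm_num)
  have hTK : IsCompact (closure T) := hTb.isCompact_closure
  have hξc : HasCompactSupport ξ :=
    HasCompactSupport.intro hTK fun x hx => hξ0 x fun h => hx (subset_closure h)
  have hI : ∫ x, w x ^ 2 = 0 := by
    by_contra hne
    have hI : 0 < ∫ x, w x ^ 2 :=
      lt_of_le_of_ne (integral_nonneg fun x => sq_nonneg _) (Ne.symm hne)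
    obtain ⟨δ, hδ, hcorr⟩ := corr_pos hw c hI
    obtain ⟨δ0, hδ0, hball⟩ := Metric.isOpen_iff.1 hTo c hc
    obtain ⟨ν, hν0, hνδ, hν4⟩ : ∃ ν : ℝ, 0 < ν ∧ ν < δ ∧ ν < 1 / 2 :=
      ⟨min (δ / 2) (1 / 4), by positivity, by have := min_le_left (δ/2) (1/4:ℝ); linarith,
        by have := min_le_right (δ/2) (1/4:ℝ); linarith⟩
    obtain ⟨μ, hμν⟩ : ∃ μ : ℝ, μ = 1 - ν := ⟨_, rfl⟩
    have hμ0 : μ ≠ 0 := by linarith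
    have hμpos : 0 < μ := by linarith
    have hμ1 : μ < 1 := by linarith
    obtain ⟨r, hr0, hrδ, hrν⟩ : ∃ r : ℝ, 0 < r ∧ r < δ ∧ r < ν * δ0 :=
      ⟨min (δ / 2) (ν * δ0 / 2), by positivity,
        by have := min_le_left (δ/2) (ν * δ0 / 2); linarith,
        by have := min_le_right (δ/2) (ν * δ0 / 2); have := mul_pos hν0 hδ0; linarith⟩
    have hS : ∀ s ∈ closure T, ∀ t : E2, ‖t‖ ≤ r → μ • (s + t) + (1 - μ) • c ∈ T := by
      intro s hs t ht
      have hv : c + (μ / ν) • t ∈ T := by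
        apply hball
        rw [Metric.mem_ball, dist_eq_norm, add_sub_cancel_left, norm_smul, Real.norm_eq_abs,
          abs_of_pos (by positivity), div_mul_eq_mul_div, div_lt_iff₀ hν0]
        nlinarith [norm_nonneg t]
      have h1 := hTc.combo_closure_interior_mem_interior hs (by rwa [hTo.interior_eq])
        hμpos.le hν0 (show μ + ν = 1 by linarith)
      rw [hTo.interior_eq] at h1
      convert h1 using 1
      rw [show 1 - μ = ν by linarith, smul_add, smul_add, smul_smul, mul_div_cancel₀ _ hν0.ne']
      abel
    let B : ContDiffBump (0 : E2) := ⟨r / 2, r, by positivity, by linarith⟩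
    set η : E2 → ℝ := B.normed volume with hηdef
    have hη : Tst η := ⟨B.contDiff_normed, B.hasCompactSupport_normed⟩
    have hη0 : ∀ y, 0 ≤ η y := B.nonneg_normed
    have hηs : ∀ y, η y ≠ 0 → ‖y‖ < r := by
      intro y hy
      have : y ∈ Function.support (B.normed volume) := hy
      rw [B.support_normed_eq] at this
      simpa [B] using this
    set b : E2 := (1 - μ) • c with hb
    set b' : E2 := -(μ⁻¹ • b) with hb'
    have hAS : ∀ z : E2, μ⁻¹ • (μ • z + b) + b' = z := by
      intro z
      rw [hb', smul_add, smul_smul, inv_mul_cancel₀ hμ0, one_smul]; abel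
    have hSA : ∀ x : E2, μ • (μ⁻¹ • x + b') + b = x := by
      intro x
      rw [hb', smul_add, smul_smul, mul_inv_cancel₀ hμ0, one_smul, smul_neg, smul_smul,
        mul_inv_cancel₀ hμ0, one_smul]; abel
    have hψ : Tst (mol η ξ) := mol_tst hη hli hξc
    set φ : E2 → ℝ := fun x => mol η ξ (μ⁻¹ • x + b') with hφdef
    have hφ : Tst φ := tst_affine hψ (inv_ne_zero hμ0) b'
    have hsupp : tsupport φ ⊆ T := by
      let f : E2 × E2 → E2 := fun p => μ • (p.1 + p.2) + b
      have hf : Continuous f := by fun_prop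
      have hK : IsCompact (f '' (closure T ×ˢ Metric.closedBall 0 r)) :=
        (hTK.prod (isCompact_closedBall _ _)).image hf
      have h1 : tsupport φ ⊆ f '' (closure T ×ˢ Metric.closedBall 0 r) := by
        apply closure_minimal _ hK.isClosed
        intro x hx
        have hx' : mol η ξ (μ⁻¹ • x + b') ≠ 0 := hx
        have : ∃ t, η t * ξ (μ⁻¹ • x + b' - t) ≠ 0 := by
          by_contra hcon
          push Not at hcon
          apply hx'
          rw [mol_apply]; simp [hcon]
        obtain ⟨t, ht⟩ := this
        have ht1 := hηs t (left_ne_zero_of_mul ht)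
        have ht2 : μ⁻¹ • x + b' - t ∈ T := by
          by_contra hcon
          exact (right_ne_zero_of_mul ht) (hξ0 _ hcon)
        refine ⟨(μ⁻¹ • x + b' - t, t), ⟨subset_closure ht2, by simpa using ht1.le⟩, ?_⟩
        simp only [f, sub_add_cancel, hSA]
      refine h1.trans ?_
      rintro _ ⟨⟨s, t⟩, ⟨hs, ht⟩, rfl⟩
      exact hS s hs t (by simpa using ht)
    have hmain := hbi φ hφ hsupp
    -- left-hand side
    have hlapφ : ∀ x, lap φ x = (μ⁻¹) ^ 2 * mol η w (μ⁻¹ • x + b') := by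
      intro x
      rw [hφdef, lap_affine hψ, mol_lap_weak hη hli hweak]
    have hL : ∫ x, ξ x * lap (lap φ) x = ∫ z, w (μ • z + b) * mol η w z := by
      rw [hweak _ hφ.lap]
      have h1 := int_affine (fun x => w x * mol η w (μ⁻¹ • x + b')) hμ0 b
      simp only [hAS] at h1
      rw [h1, ← integral_const_mul]
      congr 1; funext x
      rw [hlapφ, inv_pow]; ring
    -- right-hand side
    have hρT : MemLp (T.indicator ρ) 2 volume := by
      rw [memLp_indicator_iff_restrict hTo.measurableSet]
      have hρc := poly_continuous hρ
      obtain ⟨C, hC⟩ := hTK.exists_bound_of_continuousOn hρc.continuousOn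
      have : IsFiniteMeasure (volume.restrict T : Measure E2) :=
        ⟨by simpa using hTb.measure_lt_top⟩
      refine MemLp.of_bound hρc.aestronglyMeasurable C ?_
      filter_upwards [ae_restrict_mem hTo.measurableSet] with x hx
      exact hC x (subset_closure hx)
    have hR : ∫ x in T, ρ x * φ x = 0 := by
      rw [← integral_indicator hTo.measurableSet]
      have h1 := int_affine (fun x => T.indicator ρ x * φ x) hμ0 b
      simp only [hφdef, hAS] at h1
      have h2 := (fubini_mol (memLp_affine hρT hμ0 b) hξ hη).2
      have h3 : ∀ y, η y * ∫ z, T.indicator ρ (μ • z + b) * ξ (z - y) = 0 := by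
        intro y
        by_cases hy : η y = 0
        · simp [hy]
        have hyr := hηs y hy
        have e1 : (fun z => T.indicator ρ (μ • z + b) * ξ (z - y))
            = fun z => ρ (μ • z + b) * ξ (z - y) := by
          funext z
          by_cases hz : z - y ∈ T
          · have := hS _ (subset_closure hz) y hyr.le
            rw [sub_add_cancel] at this
            rw [indicator_of_mem this]
          · simp [hξ0 _ hz]
        rw [e1]
        have e2 := integral_add_right_eq_self (μ := (volume : Measure E2))
          (fun z => ρ (μ • z + b) * ξ (z - y)) y
        simp only [add_sub_cancel_right] at e2
        rw [← e2]
        have e3 := hmom _ (poly_affine hρ μ (μ • y + b))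
        have e4 : ∫ z, ρ (μ • (z + y) + b) * ξ z = 0 := by
          rw [← e3]
          congr 1; funext z
          rw [mul_comm, smul_add, add_assoc]
        rw [e4, mul_zero]
      simp only [h3, integral_zero] at h2
      rw [h2] at h1
      have h4 : ∫ x, T.indicator ρ x * φ x = 0 := by
        rcases mul_eq_zero.1 h1.symm with h | h
        · exact absurd h (by positivity)
        · exact h
      rw [← h4]
      congr 1; funext x
      by_cases hx : x ∈ T <;> simp [hx]
    rw [hL, hR] at hmain
    obtain ⟨hint, hfub⟩ := fubini_mol (memLp_affine hw hμ0 b) hw hη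
    rw [hfub] at hmain
    have hge : ∫ y, η y * ((∫ x, w x ^ 2) / 2)
        ≤ ∫ y, η y * ∫ z, w (μ • z + b) * w (z - y) := by
      refine integral_mono (hη.integ.mul_const _) hint fun y => ?_
      by_cases hy : η y = 0
      · simp [hy]
      · exact mul_le_mul_of_nonneg_left
          (hcorr μ (by linarith) hμ1 y ((hηs y hy).trans hrδ)) (hη0 y)
    rw [hmain, integral_mul_const, hηdef, B.integral_normed] at hge
    linarith
  have hw0 : w =ᵐ[volume] 0 := by
    have h1 := (integral_eq_zero_iff_of_nonneg (fun x => sq_nonneg (w x)) hw.integrable_sq).1 hI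
    filter_upwards [h1] with x hx
    simpa using hx
  have hweak0 : ∀ φ, Tst φ → ∫ x, ξ x * lap φ x = ∫ x, (0 : E2 → ℝ) x * φ x := by
    intro φ hφ
    rw [hweak φ hφ]
    apply integral_congr_ae
    filter_upwards [hw0] with x hx
    rw [hx]
  have hz : ∀ B : ContDiffBump (0 : E2), mol (B.normed volume) ξ = 0 := by
    intro B
    have hη : Tst (B.normed volume) := ⟨B.contDiff_normed, B.hasCompactSupport_normed⟩
    apply tst_harm_zero (mol_tst hη hli hξc)
    intro x
    rw [mol_lap_weak hη hli hweak0, mol_apply]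
    simp
  let Bn : ℕ → ContDiffBump (0 : E2) := fun n =>
    ⟨1 / ((n : ℝ) + 1) / 2, 1 / ((n : ℝ) + 1), by positivity, half_lt_self (by positivity)⟩
  have hconv := ContDiffBump.ae_convolution_tendsto_right_of_locallyIntegrable (φ := Bn)
    (l := atTop) (K := 2) (μ := (volume : Measure E2)) (g := ξ)
    tendsto_one_div_add_atTop_nhds_zero_nat
    (Eventually.of_forall fun n => by simp only [Bn]; linarith) hli
  filter_upwards [hconv] with x hx
  have hx' : Tendsto (fun i => mol ((Bn i).normed volume) ξ x) atTop (𝓝 (ξ x)) := hx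
  simp only [hz, Pi.zero_apply] at hx'
  exact tendsto_nhds_unique hx' tendsto_const_nhds

lemma tri_facts (p : Fin 3 → E2) :
    IsOpen (tri p) ∧ Convex ℝ (tri p) ∧ Bornology.IsBounded (tri p) := by
  refine ⟨isOpen_interior, (convex_convexHull ℝ _).interior, ?_⟩
  refine Bornology.IsBounded.subset ?_ interior_subset
  exact isBounded_convexHull.2 (finite_range p).isBounded

lemma trace_diff {p : Fin 3 → E2} {ξ₁ ξ₂ : E2 → ℝ} {f g : Fin 3 → ℝ → ℝ}
    {G₁ G₂ : Fin 2 → E2 → ℝ} {H₁ H₂ : Fin 2 → Fin 2 → E2 → ℝ}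
    (m₁ : MemH2W (tri p) ξ₁ G₁ H₁) (m₂ : MemH2W (tri p) ξ₂ G₂ H₂)
    (t₁ : TraceW p ξ₁ G₁ H₁ f g) (t₂ : TraceW p ξ₂ G₂ H₂ f g)
    {φ : E2 → ℝ} (hφ : Tst φ) (i : Fin 2) :
    (∫ x in tri p, ξ₁ x * pd (pd φ i) i x) - ∫ x in tri p, ξ₂ x * pd (pd φ i) i x
      = (∫ x in tri p, H₁ i i x * φ x) - ∫ x in tri p, H₂ i i x * φ x := by
  have a : ∀ {u ψ : E2 → ℝ}, L2on (tri p) u → Tst ψ →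
      Integrable (fun x => u x * ψ x) (volume.restrict (tri p)) :=
    fun hu hψ => MemLp.integrable_mul hu (hψ.memLp.restrict _)
  have hi := hφ.pd i
  have hii := hi.pd i
  have x₁ := t₁.1 (pd φ i) hi.1 hi.2 i
  have x₂ := t₂.1 (pd φ i) hi.1 hi.2 i
  have y₁ := t₁.2 i φ hφ.1 hφ.2 i
  have y₂ := t₂.2 i φ hφ.1 hφ.2 i
  rw [← x₂] at x₁
  rw [← y₂] at y₁
  change ∫ x in tri p, (ξ₁ x * pd (pd φ i) i x + G₁ i x * pd φ i x)
    = ∫ x in tri p, (ξ₂ x * pd (pd φ i) i x + G₂ i x * pd φ i x) at x₁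
  change ∫ x in tri p, (G₁ i x * pd φ i x + H₁ i i x * φ x)
    = ∫ x in tri p, (G₂ i x * pd φ i x + H₂ i i x * φ x) at y₁
  rw [integral_add (a m₁.1 hii) (a (m₁.2.1 i).1 hi),
    integral_add (a m₂.1 hii) (a (m₂.2.1 i).1 hi)] at x₁
  rw [integral_add (a (m₁.2.1 i).1 hi) (a (m₁.2.2 i i).1 hφ),
    integral_add (a (m₂.2.1 i).1 hi) (a (m₂.2.2 i i).1 hφ)] at y₁
  linarith

lemma poly_sub {m : ℤ} {u v : E2 → ℝ} (hu : IsPoly2DegLe m u) (hv : IsPoly2DegLe m v) :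
    IsPoly2DegLe m (fun x => u x - v x) := by
  obtain ⟨P, hP, hP'⟩ := hu
  obtain ⟨Q, hQ, hQ'⟩ := hv
  exact ⟨P - Q, fun d hd => by simp [hP d hd, hQ d hd], fun x => by simp [hP', hQ']⟩

lemma poly_zero (m : ℤ) : IsPoly2DegLe m (fun _ => 0) :=
  ⟨0, fun d _ => by simp, fun x => by simp⟩

lemma poly_bdd {p : Fin 3 → E2} {m : ℤ} {ρ : E2 → ℝ} (hρ : IsPoly2DegLe m ρ) :
    MemLp ρ 2 (volume.restrict (tri p)) := by
  obtain ⟨hTo, -, hTb⟩ := tri_facts p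
  have hρc := poly_continuous hρ
  obtain ⟨C, hC⟩ := hTb.isCompact_closure.exists_bound_of_continuousOn hρc.continuousOn
  have : IsFiniteMeasure (volume.restrict (tri p) : Measure E2) :=
    ⟨by simpa using hTb.measure_lt_top⟩
  refine MemLp.of_bound hρc.aestronglyMeasurable C ?_
  filter_upwards [ae_restrict_mem hTo.measurableSet] with x hx
  exact hC x (subset_closure hx)

lemma int_ind {T : Set E2} (hT : MeasurableSet T) (u v : E2 → ℝ) :
    ∫ x, T.indicator u x * v x = ∫ x in T, u x * v x := by
  rw [← integral_indicator hT]
  congr 1; funext x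
  by_cases hx : x ∈ T <;> simp [hx]

lemma unisolv {p : Fin 3 → E2} {k : ℕ} {ξ₁ ξ₂ : E2 → ℝ} {f g : Fin 3 → ℝ → ℝ}
    (h₁ : MemVEMT p k ξ₁ f g) (h₂ : MemVEMT p k ξ₂ f g)
    (hmom : ∀ q : E2 → ℝ, IsPoly2DegLe ((k : ℤ) - 4) q →
        ∫ x in tri p, ξ₁ x * q x = ∫ x in tri p, ξ₂ x * q x) :
    ξ₁ =ᵐ[volume.restrict (tri p)] ξ₂ := by
  obtain ⟨-, -, G₁, H₁, m₁, t₁, ρ₁, hρ₁, b₁⟩ := h₁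
  obtain ⟨-, -, G₂, H₂, m₂, t₂, ρ₂, hρ₂, b₂⟩ := h₂
  obtain ⟨hTo, hTc, hTb⟩ := tri_facts p
  set T := tri p with hT
  have hTm := hTo.measurableSet
  have a : ∀ {u ψ : E2 → ℝ}, L2on T u → MemLp ψ 2 (volume.restrict T) →
      Integrable (fun x => u x * ψ x) (volume.restrict T) :=
    fun hu hψ => MemLp.integrable_mul hu hψ
  have hsub : ∀ {u v ψ : E2 → ℝ}, L2on T u → L2on T v → MemLp ψ 2 (volume.restrict T) →
      ∫ x, T.indicator (fun x => u x - v x) x * ψ x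
        = (∫ x in T, u x * ψ x) - ∫ x in T, v x * ψ x := by
    intro u v ψ hu hv hψ
    rw [int_ind hTm, ← integral_sub (a hu hψ) (a hv hψ)]
    simp only [sub_mul]
  have hH₁ : L2on T (fun x => H₁ 0 0 x + H₁ 1 1 x) := MemLp.add (m₁.2.2 0 0).1 (m₁.2.2 1 1).1
  have hH₂ : L2on T (fun x => H₂ 0 0 x + H₂ 1 1 x) := MemLp.add (m₂.2.2 0 0).1 (m₂.2.2 1 1).1
  have hsum : ∀ {u v ψ : E2 → ℝ}, L2on T u → L2on T v → MemLp ψ 2 (volume.restrict T) →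
      ∫ x in T, (u x + v x) * ψ x = (∫ x in T, u x * ψ x) + ∫ x in T, v x * ψ x := by
    intro u v ψ hu hv hψ
    rw [← integral_add (a hu hψ) (a hv hψ)]
    simp only [add_mul]
  have hlap : ∀ {u φ : E2 → ℝ}, L2on T u → Tst φ → ∫ x in T, u x * lap φ x
      = (∫ x in T, u x * pd (pd φ 0) 0 x) + ∫ x in T, u x * pd (pd φ 1) 1 x := by
    intro u φ hu hφ
    rw [← integral_add (a hu (((hφ.pd 0).pd 0).memLp.restrict _))
      (a hu (((hφ.pd 1).pd 1).memLp.restrict _))]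
    simp only [lap_eq_pd, mul_add]
  have key := core (T := T) hTo hTc hTb
    (ξ := T.indicator fun x => ξ₁ x - ξ₂ x)
    (w := T.indicator fun x => (H₁ 0 0 x + H₁ 1 1 x) - (H₂ 0 0 x + H₂ 1 1 x))
    ((memLp_indicator_iff_restrict hTm).2 (MemLp.sub m₁.1 m₂.1))
    ((memLp_indicator_iff_restrict hTm).2 (MemLp.sub hH₁ hH₂))
    (fun x hx => indicator_of_notMem hx _)
    (by
      intro φ hφ
      rw [hsub m₁.1 m₂.1 (hφ.lap.memLp.restrict _), hsub hH₁ hH₂ (hφ.memLp.restrict _),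
        hlap m₁.1 hφ, hlap m₂.1 hφ, hsum (m₁.2.2 0 0).1 (m₁.2.2 1 1).1 (hφ.memLp.restrict _),
        hsum (m₂.2.2 0 0).1 (m₂.2.2 1 1).1 (hφ.memLp.restrict _)]
      have z0 := trace_diff m₁ m₂ t₁ t₂ hφ 0
      have z1 := trace_diff m₁ m₂ t₁ t₂ hφ 1
      linarith)
    (poly_sub hρ₁ hρ₂)
    (by
      intro φ hφ hs
      rw [hsub m₁.1 m₂.1 (hφ.lap.lap.memLp.restrict _), b₁ φ hφ.1 hφ.2 hs, b₂ φ hφ.1 hφ.2 hs,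
        ← integral_sub (a (poly_bdd hρ₁) (hφ.memLp.restrict _)) (a (poly_bdd hρ₂) (hφ.memLp.restrict _))]
      simp only [sub_mul])
    (by
      intro q hq
      rw [hsub m₁.1 m₂.1 (poly_bdd hq), hmom q hq, sub_self])
  rw [Filter.EventuallyEq, ae_restrict_iff' hTm]
  filter_upwards [key] with x hx hxT
  rw [indicator_of_mem hxT] at hx
  simpa [sub_eq_zero] using hx

lemma memVEMT_zero (p : Fin 3 → E2) (k : ℕ) :
    MemVEMT p k (fun _ => 0) (fun _ _ => 0) (fun _ _ => 0) := by
  refine ⟨fun i => ⟨⟨0, by simp, by simp⟩, ⟨0, by simp, by simp⟩⟩, ⟨by simp, fun _ => 0, ?_⟩,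
    fun _ _ => 0, fun _ _ _ => 0, ⟨?_, ?_, ?_⟩, ⟨?_, ?_⟩, fun _ => 0, poly_zero _, by simp⟩
  · intro i j _
    simp
  · exact MemLp.zero
  · exact fun d => ⟨MemLp.zero, fun φ _ _ _ => by simp⟩
  · exact fun d d' => ⟨MemLp.zero, fun φ _ _ _ => by simp⟩
  · intro φ _ _ d; simp
  · intro d φ _ _ d'; simp [gfield]

theorem vem_unisolvence_reference (k : ℕ) (hk : 3 ≤ k) :
    -- a function in 𝒱^k(T̂) is determined by its trace and its moments up to order k-4
    (∀ (ξ₁ ξ₂ : E2 → ℝ) (f g : Fin 3 → ℝ → ℝ),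
      MemVEMT refTri k ξ₁ f g → MemVEMT refTri k ξ₂ f g →
      (∀ q : E2 → ℝ, IsPoly2DegLe ((k : ℤ) - 4) q →
        ∫ x in tri refTri, ξ₁ x * q x = ∫ x in tri refTri, ξ₂ x * q x) →
      ξ₁ =ᵐ[volume.restrict (tri refTri)] ξ₂) ∧
    -- in particular, if the trace and the projection vanish then ξ = 0
    (∀ ξ : E2 → ℝ,
      MemVEMT refTri k ξ (fun _ _ => 0) (fun _ _ => 0) →
      (∀ q : E2 → ℝ, IsPoly2DegLe ((k : ℤ) - 4) q → ∫ x in tri refTri, ξ x * q x = 0) →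
      ξ =ᵐ[volume.restrict (tri refTri)] (fun _ => (0:ℝ))) := by
  refine ⟨fun ξ₁ ξ₂ f g h₁ h₂ h => unisolv h₁ h₂ h, fun ξ hξ h => ?_⟩
  exact unisolv hξ (memVEMT_zero refTri k) fun q hq => by rw [h q hq]; simp
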